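/- Let d ≥ 2, let s > 0, and let r > s be an integer. Then there exist constants C₀ > 0 and c > 0, depending only on d, s, r, such that for every natural number k and every finite set X ⊂ (0,1)^d with |X| = 2^(kd) =: m̃, there exists a continuous function η : ℝ^d → [0,∞), supported in [0,1]^d and vanishing at every point of X, satisfying ‖η‖_{L^∞(ℝ^d)} + sup_{t>0} t^(−s)·ω_r(η,t)_∞ ≤ C₀, and such that ∫_{[1/4,3/4]^d} η(x) dx ≥ c · m̃^(−s/d). -/

import Mathlib

open MeasureTheory ENNReal

/-- The `r`-th forward finite difference `Δ_h^r f(x) = Σ_{j=0}^r (−1)^(r−j) C(r,j) f(x + j h)`. -/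
noncomputable def finDiffOp (d : ℕ) (r : ℕ) (h : EuclideanSpace ℝ (Fin d))
    (f : EuclideanSpace ℝ (Fin d) → ℝ) (x : EuclideanSpace ℝ (Fin d)) : ℝ :=
  ∑ j ∈ Finset.range (r + 1), (-1 : ℝ) ^ (r - j) * (r.choose j : ℝ) * f (x + (j : ℝ) • h)

/-- The modulus of smoothness `ω_r(f,t)_p = sup_{|h| ≤ t} ‖Δ_h^r f‖_{L^p(ℝ^d)}`,
with values in `[0,∞]`. -/
noncomputable def modulus (d r : ℕ) (f : EuclideanSpace ℝ (Fin d) → ℝ)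
    (p : ℝ≥0∞) (t : ℝ) : ℝ≥0∞ :=
  ⨆ (h : EuclideanSpace ℝ (Fin d)) (_ : ‖h‖ ≤ t),
    eLpNorm (finDiffOp d r h f) p volume

/-- The Besov `B^s_{p,∞}` seminorm `sup_{t>0} t^(−s) ω_r(f,t)_p`, valued in `[0,∞]`. -/
noncomputable def besovSeminorm (d r : ℕ) (s : ℝ) (p : ℝ≥0∞)
    (f : EuclideanSpace ℝ (Fin d) → ℝ) : ℝ≥0∞ :=
  ⨆ (t : ℝ) (_ : 0 < t), ENNReal.ofReal (t ^ (-s)) * modulus d r f p t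

/-- Iterated forward differences are controlled by the iterated derivative of the same order. -/
theorem norm_fwdDiff_iter_le_of_norm_iteratedFDeriv_le {E F : Type*} [NormedAddCommGroup E]
    [NormedSpace ℝ E] [NormedAddCommGroup F] [NormedSpace ℝ F] (n : ℕ) {f : E → F} {C : ℝ}
    (hf : ContDiff ℝ n f) (hC : ∀ x, ‖iteratedFDeriv ℝ n f x‖ ≤ C) (h x : E) :
    ‖(fwdDiff h)^[n] f x‖ ≤ C * ‖h‖ ^ n := by
  induction n generalizing f C with
  | zero => simpa using hC x
  | succ n ih =>
    have hfn : ContDiff ℝ n f := hf.of_le (by exact_mod_cast n.le_succ)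
    have hshift : ContDiff ℝ n fun y => f (y + h) := hfn.comp (contDiff_id.add contDiff_const)
    have hdiff : Differentiable ℝ (iteratedFDeriv ℝ n f) :=
      hf.differentiable_iteratedFDeriv (by exact_mod_cast n.lt_succ_self)
    have key : ∀ y, ‖iteratedFDeriv ℝ n (fwdDiff h f) y‖ ≤ C * ‖h‖ := fun y => by
      have heq : iteratedFDeriv ℝ n (fwdDiff h f) y
          = iteratedFDeriv ℝ n f (y + h) - iteratedFDeriv ℝ n f y := by
        have : fwdDiff h f = (fun y => f (y + h)) - f := rfl
        rw [this, iteratedFDeriv_sub_apply hshift.contDiffAt hfn.contDiffAt,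
          iteratedFDeriv_comp_add_right]
      rw [heq]
      have := convex_univ.norm_image_sub_le_of_norm_fderiv_le (𝕜 := ℝ)
        (f := iteratedFDeriv ℝ n f) (C := C) (fun z _ => hdiff z)
        (fun z _ => by rw [norm_fderiv_iteratedFDeriv]; exact hC z)
        (Set.mem_univ y) (Set.mem_univ (y + h))
      simpa using this
    rw [Function.iterate_succ_apply]
    refine (ih (hshift.sub hfn) key).trans_eq ?_
    ring

theorem finDiffOp_eq_fwdDiff_iter (d r : ℕ) (h : EuclideanSpace ℝ (Fin d))
    (f : EuclideanSpace ℝ (Fin d) → ℝ) (x : EuclideanSpace ℝ (Fin d)) :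
    finDiffOp d r h f x = (fwdDiff h)^[r] f x := by
  rw [fwdDiff_iter_eq_sum_shift]
  refine Finset.sum_congr rfl fun j _ => ?_
  rw [zsmul_eq_mul, Nat.cast_smul_eq_nsmul]
  push_cast
  ring

theorem abs_finDiffOp_le_of_abs_le (d r : ℕ) (h : EuclideanSpace ℝ (Fin d))
    {f : EuclideanSpace ℝ (Fin d) → ℝ} {M : ℝ} (hM : ∀ x, |f x| ≤ M)
    (x : EuclideanSpace ℝ (Fin d)) : |finDiffOp d r h f x| ≤ 2 ^ r * M := by
  have hsum : ∑ j ∈ Finset.range (r + 1), (r.choose j : ℝ) = 2 ^ r := by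
    exact_mod_cast Nat.sum_range_choose r
  rw [← hsum, Finset.sum_mul]
  refine (Finset.abs_sum_le_sum_abs _ _).trans (Finset.sum_le_sum fun j _ => ?_)
  rw [abs_mul, abs_mul, abs_pow, abs_neg, abs_one, one_pow, one_mul, Nat.abs_cast]
  exact mul_le_mul_of_nonneg_left (hM _) (Nat.cast_nonneg _)

/-- A compactly supported function of class `C^r` has Hölder–Zygmund finite differences of every
order `s ∈ [0, r]`. -/
theorem HasCompactSupport.exists_abs_finDiffOp_le_rpow {d r : ℕ} {s : ℝ} (hs : 0 ≤ s)
    (hsr : s ≤ r) {f : EuclideanSpace ℝ (Fin d) → ℝ} (hf : ContDiff ℝ r f)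
    (hc : HasCompactSupport f) :
    ∃ K, 0 ≤ K ∧ ∀ h x, |finDiffOp d r h f x| ≤ K * ‖h‖ ^ s := by
  obtain ⟨A, hA⟩ := (hc.iteratedFDeriv (𝕜 := ℝ) r).exists_bound_of_continuous
    (hf.continuous_iteratedFDeriv le_rfl)
  obtain ⟨M, hM⟩ := hc.exists_bound_of_continuous hf.continuous
  have hA0 : 0 ≤ A := (norm_nonneg _).trans (hA 0)
  have hM0 : 0 ≤ M := (norm_nonneg _).trans (hM 0)
  refine ⟨A + 2 ^ r * M, by positivity, fun h x => ?_⟩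
  have hhs : 0 ≤ ‖h‖ ^ s := by positivity
  rcases le_total ‖h‖ 1 with h1 | h1
  · calc |finDiffOp d r h f x| ≤ A * ‖h‖ ^ r := by
          rw [finDiffOp_eq_fwdDiff_iter]
          exact norm_fwdDiff_iter_le_of_norm_iteratedFDeriv_le r hf hA h x
      _ ≤ A * ‖h‖ ^ s := by
          rw [← Real.rpow_natCast]
          exact mul_le_mul_of_nonneg_left
            (Real.rpow_le_rpow_of_exponent_ge' (norm_nonneg h) h1 hs hsr) hA0
      _ ≤ (A + 2 ^ r * M) * ‖h‖ ^ s :=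
          mul_le_mul_of_nonneg_right (le_add_of_nonneg_right (by positivity)) hhs
  · calc |finDiffOp d r h f x| ≤ 2 ^ r * M * 1 := by
          rw [mul_one]
          exact abs_finDiffOp_le_of_abs_le d r h hM x
      _ ≤ 2 ^ r * M * ‖h‖ ^ s :=
          mul_le_mul_of_nonneg_left (Real.one_le_rpow h1 hs) (by positivity)
      _ ≤ (A + 2 ^ r * M) * ‖h‖ ^ s :=
          mul_le_mul_of_nonneg_right (le_add_of_nonneg_left hA0) hhs

theorem besovSeminorm_top_le {d r : ℕ} {s K : ℝ} (hs : 0 ≤ s)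
    (hK : 0 ≤ K) {f : EuclideanSpace ℝ (Fin d) → ℝ}
    (hf : ∀ h x, |finDiffOp d r h f x| ≤ K * ‖h‖ ^ s) :
    besovSeminorm d r s ∞ f ≤ ENNReal.ofReal K := by
  refine iSup₂_le fun t ht => ?_
  have hmod : modulus d r f ∞ t ≤ ENNReal.ofReal (K * t ^ s) := by
    refine iSup₂_le fun h hh => ?_
    rw [eLpNorm_exponent_top]
    refine eLpNormEssSup_le_of_ae_bound (Filter.Eventually.of_forall fun x => (hf h x).trans ?_)
    gcongr
  calc ENNReal.ofReal (t ^ (-s)) * modulus d r f ∞ t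
      ≤ ENNReal.ofReal (t ^ (-s)) * ENNReal.ofReal (K * t ^ s) := by gcongr
    _ = ENNReal.ofReal K := by
        rw [← ENNReal.ofReal_mul (by positivity), Real.rpow_neg ht.le]
        congr 1
        have : t ^ s ≠ 0 := (Real.rpow_pos_of_pos ht s).ne'
        field_simp

/-- The sum of copies of `φ` rescaled to the cells `(ℓ + (0,1)^d) / N` for `ℓ ∈ L`. -/
noncomputable def gridBumps {d : ℕ} (φ : EuclideanSpace ℝ (Fin d) → ℝ) (N : ℝ)
    (L : Finset (Fin d → ℤ)) (x : EuclideanSpace ℝ (Fin d)) : ℝ :=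
  ∑ l ∈ L, φ (N • x - WithLp.toLp 2 fun i => (l i : ℝ))

section gridBumps

variable {d : ℕ} {φ : EuclideanSpace ℝ (Fin d) → ℝ} {N : ℝ} {L : Finset (Fin d → ℤ)}

theorem eq_floor_of_bump_ne_zero (hφ : ∀ z, φ z ≠ 0 → ∀ i, z i ∈ Set.Ioo (0 : ℝ) 1)
    {l : Fin d → ℤ} {y : EuclideanSpace ℝ (Fin d)}
    (h : φ (y - WithLp.toLp 2 fun i => (l i : ℝ)) ≠ 0) : l = fun i => ⌊y i⌋ := by
  funext i
  have := hφ _ h i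
  simp only [PiLp.sub_apply, Set.mem_Ioo] at this
  exact (Int.floor_eq_iff.2 ⟨by linarith, by linarith⟩).symm

theorem finDiffOp_gridBumps (r : ℕ) (h x : EuclideanSpace ℝ (Fin d)) :
    finDiffOp d r h (gridBumps φ N L) x
      = ∑ l ∈ L, finDiffOp d r (N • h) φ (N • x - WithLp.toLp 2 fun i => (l i : ℝ)) := by
  simp only [finDiffOp, gridBumps, Finset.mul_sum]
  rw [Finset.sum_comm]
  refine Finset.sum_congr rfl fun l _ => Finset.sum_congr rfl fun j _ => ?_
  congr 2
  rw [smul_add, smul_comm]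
  abel

theorem abs_gridBumps_le (hφ : ∀ z, φ z ≠ 0 → ∀ i, z i ∈ Set.Ioo (0 : ℝ) 1) {M : ℝ}
    (hM : ∀ z, |φ z| ≤ M) (x : EuclideanSpace ℝ (Fin d)) : |gridBumps φ N L x| ≤ M := by
  have hM0 : 0 ≤ M := (abs_nonneg _).trans (hM 0)
  calc |gridBumps φ N L x|
      ≤ ∑ l ∈ L, if l = (fun i => ⌊(N • x) i⌋) then M else 0 := by
        refine (Finset.abs_sum_le_sum_abs _ _).trans (Finset.sum_le_sum fun l _ => ?_)
        split_ifs with h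
        · exact hM _
        · rw [not_imp_comm.1 (eq_floor_of_bump_ne_zero hφ) h, abs_zero]
    _ ≤ M := by
        rw [Finset.sum_ite_eq']
        split_ifs <;> simp [hM0]

theorem abs_finDiffOp_gridBumps_le (hφ : ∀ z, φ z ≠ 0 → ∀ i, z i ∈ Set.Ioo (0 : ℝ) 1) {r : ℕ}
    {h : EuclideanSpace ℝ (Fin d)} {B : ℝ} (hB : ∀ z, |finDiffOp d r (N • h) φ z| ≤ B)
    (x : EuclideanSpace ℝ (Fin d)) :
    |finDiffOp d r h (gridBumps φ N L) x| ≤ (r + 1) * B := by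
  have hB0 : 0 ≤ B := (abs_nonneg _).trans (hB 0)
  let c : ℕ → Fin d → ℤ := fun j i => ⌊(N • x + (j : ℝ) • N • h) i⌋
  calc |finDiffOp d r h (gridBumps φ N L) x|
      ≤ ∑ l ∈ L, ∑ j ∈ Finset.range (r + 1), if l = c j then B else 0 := by
        rw [finDiffOp_gridBumps]
        refine (Finset.abs_sum_le_sum_abs _ _).trans (Finset.sum_le_sum fun l _ => ?_)
        by_cases hl : ∃ j ∈ Finset.range (r + 1), l = c j
        · obtain ⟨j, hj, hlj⟩ := hl
          refine (hB _).trans ?_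
          have := Finset.single_le_sum (f := fun j => if l = c j then B else 0)
            (fun j _ => by positivity) hj
          simpa only [if_pos hlj] using this
        · have hzero : finDiffOp d r (N • h) φ
              (N • x - WithLp.toLp 2 fun i => (l i : ℝ)) = 0 := by
            refine Finset.sum_eq_zero fun j hj => ?_
            rw [sub_add_eq_add_sub, not_imp_comm.1 (eq_floor_of_bump_ne_zero hφ)
              fun hlj => hl ⟨j, hj, hlj⟩, mul_zero]
          rw [hzero, abs_zero]
          positivity
    _ = ∑ j ∈ Finset.range (r + 1), ∑ l ∈ L, if l = c j then B else 0 := Finset.sum_comm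
    _ ≤ ∑ j ∈ Finset.range (r + 1), B := by
        refine Finset.sum_le_sum fun j _ => ?_
        rw [Finset.sum_ite_eq']
        split_ifs <;> simp [hB0]
    _ = (r + 1) * B := by simp

theorem setIntegral_gridBumps (hφ : ∀ z, φ z ≠ 0 → ∀ i, z i ∈ Set.Ioo (0 : ℝ) 1)
    (hint : Integrable φ) (hN : 0 < N) {S : Set (EuclideanSpace ℝ (Fin d))}
    (hS : ∀ l ∈ L, ∀ x : EuclideanSpace ℝ (Fin d),
      (∀ i, N * x i - l i ∈ Set.Ioo (0 : ℝ) 1) → x ∈ S) :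
    ∫ x in S, gridBumps φ N L x = L.card * ((N ^ d)⁻¹ * ∫ z, φ z) := by
  have hbump : ∀ l ∈ L, ∫ x in S, φ (N • x - WithLp.toLp 2 fun i => (l i : ℝ))
      = (N ^ d)⁻¹ * ∫ z, φ z := fun l hl => by
    rw [setIntegral_eq_integral_of_forall_compl_eq_zero fun x hx => ?_]
    · rw [Measure.integral_comp_smul volume
        (fun y => φ (y - WithLp.toLp 2 fun i => (l i : ℝ))), integral_sub_right_eq_self,
        finrank_euclideanSpace_fin, abs_of_pos (by positivity), smul_eq_mul]
    · by_contra hne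
      exact hx (hS l hl x fun i => by simpa using hφ _ hne i)
  simp only [gridBumps]
  rw [integral_finsetSum _ fun l _ => ?_, Finset.sum_congr rfl hbump, Finset.sum_const,
    nsmul_eq_mul]
  exact ((hint.comp_sub_right _).comp_smul hN.ne').integrableOn

end gridBumps

/-- There is a smooth nonnegative bump supported in the open unit cube. -/
theorem exists_bump_unitCube (d : ℕ) :
    ∃ φ : EuclideanSpace ℝ (Fin d) → ℝ, (∀ n : ℕ, ContDiff ℝ n φ) ∧ HasCompactSupport φ ∧
      (∀ z, 0 ≤ φ z) ∧ (∀ z, φ z ≤ 1) ∧ (∀ z, φ z ≠ 0 → ∀ i, z i ∈ Set.Ioo (0 : ℝ) 1) ∧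
      0 < ∫ z, φ z := by
  let c : EuclideanSpace ℝ (Fin d) := WithLp.toLp 2 fun _ => 1 / 2
  let b : ContDiffBump c := ⟨1 / 4, 1 / 2, by norm_num, by norm_num⟩
  refine ⟨b, fun n => b.contDiff, b.hasCompactSupport, fun z => b.nonneg, fun z => b.le_one,
    fun z hz i => ?_, b.integral_pos⟩
  have hz' : z ∈ Metric.ball c (1 / 2) := by
    rw [← b.support_eq]
    exact hz
  have hi : |z i - 1 / 2| < 1 / 2 :=
    (PiLp.norm_apply_le (z - c) i).trans_lt (mem_ball_iff_norm.1 hz')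
  rw [abs_lt] at hi
  exact ⟨by linarith, by linarith⟩

theorem sum_of_bumps_lower_bound (d : ℕ) (hd : 2 ≤ d) (s : ℝ) (hs : 0 < s)
    (r : ℕ) (hr : (s : ℝ) < r) :
    ∃ C₀ c : ℝ, 0 < C₀ ∧ 0 < c ∧
      ∀ k : ℕ, ∀ X : Finset (EuclideanSpace ℝ (Fin d)),
        (∀ x ∈ X, ∀ i : Fin d, x i ∈ Set.Ioo (0 : ℝ) 1) →
        X.card = 2 ^ (k * d) →
        ∃ η : EuclideanSpace ℝ (Fin d) → ℝ,
          Continuous η ∧ (∀ x, 0 ≤ η x) ∧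
          (Function.support η ⊆ {x | ∀ i : Fin d, x i ∈ Set.Icc (0 : ℝ) 1}) ∧
          (∀ x ∈ X, η x = 0) ∧
          (eLpNorm η ∞ volume + besovSeminorm d r s ∞ η ≤ ENNReal.ofReal C₀) ∧
          c * ((2 ^ (k * d) : ℕ) : ℝ) ^ (-(s / d)) ≤
            ∫ x in {x : EuclideanSpace ℝ (Fin d) |
              ∀ i : Fin d, x i ∈ Set.Icc (1 / 4 : ℝ) (3 / 4)}, η x := by
  obtain ⟨φ, hsm, hcs, h0, h1, hsupp, hpos⟩ := exists_bump_unitCube d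
  obtain ⟨K, hK0, hK⟩ := hcs.exists_abs_finDiffOp_le_rpow hs.le hr.le (hsm r)
  refine ⟨1 + (r + 1) * K, 4 ^ (-s) * ((4 ^ d)⁻¹ * ∫ z, φ z), by positivity, by positivity,
    fun k X _ hcard => ?_⟩
  let N : ℝ := 4 * 2 ^ k
  have hN : 0 < N := by positivity
  have hN1 : 1 ≤ N := by
    have : (1 : ℝ) ≤ 2 ^ k := one_le_pow₀ (by norm_num)
    simp only [N]
    linarith
  let cell : EuclideanSpace ℝ (Fin d) → Fin d → ℤ := fun x i => ⌊(N • x) i⌋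
  let P : Finset (Fin d → ℤ) := Fintype.piFinset fun _ => Finset.Ico (2 ^ k) (3 * 2 ^ k)
  let L : Finset (Fin d → ℤ) := P \ X.image cell
  have hinner : ∀ l ∈ L, ∀ x : EuclideanSpace ℝ (Fin d),
      (∀ i, N * x i - l i ∈ Set.Ioo (0 : ℝ) 1) → ∀ i, x i ∈ Set.Icc (1 / 4 : ℝ) (3 / 4) := by
    intro l hl x hx i
    have hli := Finset.mem_Ico.1 (Fintype.mem_piFinset.1 (Finset.mem_sdiff.1 hl).1 i)
    have hlo : (2 ^ k : ℝ) ≤ l i := by exact_mod_cast hli.1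
    have hhi : (l i : ℝ) + 1 ≤ 3 * 2 ^ k := by exact_mod_cast hli.2
    obtain ⟨hx0, hx1⟩ := hx i
    have h2k : (0 : ℝ) < 2 ^ k := by positivity
    simp only [N] at hx0 hx1
    constructor
    · refine le_of_mul_le_mul_left ?_ h2k
      linarith
    · refine le_of_mul_le_mul_left ?_ h2k
      linarith
  have hLcard : ((2 ^ (k * d) : ℕ) : ℝ) ≤ L.card := by
    have hP : P.card = 2 ^ d * 2 ^ (k * d) := by
      have : ((3 * 2 ^ k - 2 ^ k : ℤ)).toNat = 2 * 2 ^ k := by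
        have : (3 * 2 ^ k - 2 ^ k : ℤ) = ((2 * 2 ^ k : ℕ) : ℤ) := by push_cast; ring
        rw [this, Int.toNat_natCast]
      simp only [P, Fintype.card_piFinset, Int.card_Ico, this, Finset.prod_const,
        Finset.card_univ, Fintype.card_fin, mul_pow, ← pow_mul]
    have hle : P.card - (X.image cell).card ≤ L.card := Finset.le_card_sdiff _ _
    have himg : (X.image cell).card ≤ 2 ^ (k * d) := Finset.card_image_le.trans hcard.le
    have h2d : 2 * 2 ^ (k * d) ≤ 2 ^ d * 2 ^ (k * d) :=
      Nat.mul_le_mul_right _ (le_self_pow₀ (by norm_num) (by omega))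
    have : 2 ^ (k * d) ≤ L.card := by omega
    exact_mod_cast this
  have hNs : 0 < N ^ (-s) := Real.rpow_pos_of_pos hN _
  have hzero : ∀ x, (∀ l ∈ L, φ (N • x - WithLp.toLp 2 fun i => (l i : ℝ)) = 0) →
      N ^ (-s) * gridBumps φ N L x = 0 := fun x hx => by
    rw [gridBumps, Finset.sum_eq_zero hx, mul_zero]
  refine ⟨fun x => N ^ (-s) * gridBumps φ N L x, ?_, fun x => ?_, fun x hx => ?_, fun x hx => ?_,
    ?_, ?_⟩
  · have hφc : Continuous φ := (hsm 0).continuous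
    unfold gridBumps
    fun_prop
  · exact mul_nonneg hNs.le (Finset.sum_nonneg fun l _ => h0 _)
  · obtain ⟨l, hl, hne⟩ : ∃ l ∈ L, φ (N • x - WithLp.toLp 2 fun i => (l i : ℝ)) ≠ 0 := by
      by_contra! hcon
      exact hx (hzero x hcon)
    intro i
    have := hinner l hl x (fun i => by simpa using hsupp _ hne i) i
    exact ⟨by linarith [this.1], by linarith [this.2]⟩
  · refine hzero x fun l hl => ?_
    by_contra hne
    refine (Finset.mem_sdiff.1 hl).2 ?_
    rw [eq_floor_of_bump_ne_zero hsupp hne]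
    exact Finset.mem_image_of_mem cell hx
  · rw [ENNReal.ofReal_add zero_le_one (by positivity)]
    refine add_le_add ?_ (besovSeminorm_top_le hs.le (by positivity) fun h x => ?_)
    · rw [eLpNorm_exponent_top]
      refine eLpNormEssSup_le_of_ae_bound (Filter.Eventually.of_forall fun x => ?_)
      rw [Real.norm_eq_abs, abs_mul, abs_of_pos hNs]
      refine mul_le_one₀ (Real.rpow_le_one_of_one_le_of_nonpos hN1 (by linarith)) (abs_nonneg _) ?_
      exact abs_gridBumps_le hsupp (fun z => (abs_of_nonneg (h0 z)).trans_le (h1 z)) x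
    · have hmul : finDiffOp d r h (fun x => N ^ (-s) * gridBumps φ N L x) x
          = N ^ (-s) * finDiffOp d r h (gridBumps φ N L) x := by
        simp only [finDiffOp, Finset.mul_sum]
        exact Finset.sum_congr rfl fun j _ => by ring
      rw [hmul, abs_mul, abs_of_pos hNs]
      calc N ^ (-s) * |finDiffOp d r h (gridBumps φ N L) x|
          ≤ N ^ (-s) * ((r + 1) * (K * ‖N • h‖ ^ s)) := by
            gcongr
            exact abs_finDiffOp_gridBumps_le hsupp (hK _) x
        _ = (r + 1) * K * ‖h‖ ^ s := by
            rw [norm_smul, Real.norm_of_nonneg hN.le, Real.mul_rpow hN.le (norm_nonneg h),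
              Real.rpow_neg hN.le]
            have : N ^ s ≠ 0 := (Real.rpow_pos_of_pos hN s).ne'
            field_simp
  · rw [integral_const_mul, setIntegral_gridBumps
      (S := {x | ∀ i : Fin d, x i ∈ Set.Icc (1 / 4 : ℝ) (3 / 4)}) hsupp
      ((hsm 0).continuous.integrable_of_hasCompactSupport hcs) hN hinner]
    have hpow : ((2 ^ (k * d) : ℕ) : ℝ) ^ (-(s / d)) = ((2 : ℝ) ^ k) ^ (-s) := by
      have hd0 : (d : ℝ) ≠ 0 := by
        have : d ≠ 0 := by omega
        exact_mod_cast this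
      push_cast
      rw [pow_mul, ← Real.rpow_natCast _ d, ← Real.rpow_mul (by positivity)]
      congr 1
      field_simp
    have hNd : (N ^ d)⁻¹ = (4 ^ d)⁻¹ * (((2 ^ (k * d) : ℕ) : ℝ))⁻¹ := by
      simp only [N]
      push_cast
      rw [mul_pow, mul_inv, pow_mul]
    calc 4 ^ (-s) * ((4 ^ d)⁻¹ * ∫ z, φ z) * ((2 ^ (k * d) : ℕ) : ℝ) ^ (-(s / d))
        = N ^ (-s) * (((2 ^ (k * d) : ℕ) : ℝ) * ((N ^ d)⁻¹ * ∫ z, φ z)) := by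
          rw [hpow, hNd, Real.mul_rpow (by norm_num) (by positivity)]
          field_simp
      _ ≤ N ^ (-s) * (L.card * ((N ^ d)⁻¹ * ∫ z, φ z)) := by gcongr
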